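/- The support of L(p) = N/N'' is exactly p̄: for m : I → k, the weight space (N/N'')_m is nonzero if and only if m ∈ p̄, and in that case it is one-dimensional over k. -/

import Mathlib

set_option synthInstance.maxHeartbeats 1000000
set_option maxHeartbeats 4000000

noncomputable section

open MvPolynomial

universe u v

variable (k : Type u) (I : Type v) [Field k]

/-- Multiplication by the variable `x i` on the polynomial algebra `B`. -/
def Xop (i : I) : Module.End k (MvPolynomial I k) :=
  LinearMap.mulLeft k (MvPolynomial.X i)

/-- The partial derivative `∂/∂x i` on the polynomial algebra `B`. -/
def Yop (i : I) : Module.End k (MvPolynomial I k) :=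
  (MvPolynomial.pderiv i).toLinearMap

/-- The infinite Weyl algebra `A`: the subalgebra of `Module.End k B` generated by
all `X i` and `Y i`. -/
def Weyl : Subalgebra k (Module.End k (MvPolynomial I k)) :=
  Algebra.adjoin k (Set.range (Xop k I) ∪ Set.range (Yop k I))

instance : Ring (Weyl k I) := inferInstance
instance : Algebra k (Weyl k I) := inferInstance

/-- `X i` as an element of the Weyl algebra. -/
def XA (i : I) : Weyl k I :=
  ⟨Xop k I i, Algebra.subset_adjoin (Set.mem_union_left _ ⟨i, rfl⟩)⟩

/-- `Y i` as an element of the Weyl algebra. -/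
def YA (i : I) : Weyl k I :=
  ⟨Yop k I i, Algebra.subset_adjoin (Set.mem_union_right _ ⟨i, rfl⟩)⟩

/-- `t i = X i * Y i` as an element of the Weyl algebra. -/
def tA (i : I) : Weyl k I := XA k I i * YA k I i

/-- The shift operator `S i : e_v ↦ e_{v + δ i}` on the free module `(I →₀ ℤ) →₀ k`. -/
def Sop (i : I) : Module.End k ((I →₀ ℤ) →₀ k) :=
  Finsupp.lmapDomain k k (fun v => v + Finsupp.single i 1)

/-- The twisted derivative operator `D i : e_v ↦ (p i + v i) • e_{v - δ i}`. -/
def Dop (p : I → k) (i : I) : Module.End k ((I →₀ ℤ) →₀ k) :=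
  Finsupp.lsum k fun v =>
    LinearMap.toSpanSingleton k ((I →₀ ℤ) →₀ k)
      ((p i + ((v i : ℤ) : k)) • Finsupp.single (v - Finsupp.single i 1) (1 : k))

/-- The space `V = (I →₀ ℤ) →₀ k` regarded as a module over the Weyl algebra through a
homomorphism `ρ : A →ₐ[k] End_k V`; this is the module `B(p)` when `ρ = ρ_p`. -/
def BMod (ρ : Weyl k I →ₐ[k] Module.End k ((I →₀ ℤ) →₀ k)) : Type (max u v) :=
  (I →₀ ℤ) →₀ k

variable {k I} in
instance (ρ : Weyl k I →ₐ[k] Module.End k ((I →₀ ℤ) →₀ k)) : AddCommGroup (BMod k I ρ) :=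
  inferInstanceAs (AddCommGroup ((I →₀ ℤ) →₀ k))

variable {k I} in
instance (ρ : Weyl k I →ₐ[k] Module.End k ((I →₀ ℤ) →₀ k)) : Module k (BMod k I ρ) :=
  inferInstanceAs (Module k ((I →₀ ℤ) →₀ k))

variable {k I} in
instance (ρ : Weyl k I →ₐ[k] Module.End k ((I →₀ ℤ) →₀ k)) :
    Module (Weyl k I) (BMod k I ρ) where
  smul a x := ρ a x
  one_smul x := by show ρ 1 x = x; rw [map_one]; rfl
  mul_smul a b x := by show ρ (a * b) x = ρ a (ρ b x); rw [map_mul]; rfl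
  smul_zero a := map_zero (ρ a)
  smul_add a x y := map_add (ρ a) x y
  add_smul a b x := by show ρ (a + b) x = ρ a x + ρ b x; rw [map_add]; rfl
  zero_smul x := by show ρ 0 x = 0; rw [map_zero]; rfl

variable {k I} in
instance (ρ : Weyl k I →ₐ[k] Module.End k ((I →₀ ℤ) →₀ k)) :
    IsScalarTower k (Weyl k I) (BMod k I ρ) :=
  ⟨fun c a x => by
    show ρ (c • a) x = c • (ρ a x)
    rw [map_smul]
    rfl⟩

/-- The basis vector `e_v` of `B(p)`. -/
def eV (ρ : Weyl k I →ₐ[k] Module.End k ((I →₀ ℤ) →₀ k)) (v : I →₀ ℤ) : BMod k I ρ :=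
  Finsupp.single v 1

/-- `c` is a nonnegative integer. -/
def IsNonnegInt (c : k) : Prop := ∃ n : ℕ, c = n

/-- `c` is a negative integer. -/
def IsNegInt (c : k) : Prop := ∃ m : ℤ, m < 0 ∧ c = m

/-- The index set `S` of the submodule `N ⊆ B(p)`. -/
def Sset (p : I → k) : Set (I →₀ ℤ) :=
  {v | ∀ i, IsNonnegInt k (p i) → IsNonnegInt k (p i + ((v i : ℤ) : k))}

/-- The index set `S''` of the submodule `N'' ⊆ N`. -/
def Sset'' (p : I → k) : Set (I →₀ ℤ) :=
  {v | v ∈ Sset k I p ∧ ∃ i, IsNegInt k (p i) ∧ IsNonnegInt k (p i + ((v i : ℤ) : k))}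

/-- The `k`-span `N` of the `e_v`, `v ∈ S`. -/
def Nspan (p : I → k) (ρ : Weyl k I →ₐ[k] Module.End k ((I →₀ ℤ) →₀ k)) :
    Submodule k (BMod k I ρ) :=
  Submodule.span k {x | ∃ v ∈ Sset k I p, x = eV k I ρ v}

/-- The `k`-span `N''` of the `e_v`, `v ∈ S''`. -/
def Nspan'' (p : I → k) (ρ : Weyl k I →ₐ[k] Module.End k ((I →₀ ℤ) →₀ k)) :
    Submodule k (BMod k I ρ) :=
  Submodule.span k {x | ∃ v ∈ Sset'' k I p, x = eV k I ρ v}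

/-- The weight space of weight `p` in a module over the Weyl algebra:
all `x` with `t i • x = p i • x` for every `i`. -/
def wtSp (M : Type*) [AddCommGroup M] [Module k M] [Module (Weyl k I) M]
    [IsScalarTower k (Weyl k I) M] (p : I → k) : Submodule k M where
  carrier := {x | ∀ i, tA k I i • x = p i • x}
  add_mem' := by
    intro a b ha hb i
    rw [smul_add, ha i, hb i, ← smul_add]
  zero_mem' := by intro i; rw [smul_zero, smul_zero]
  smul_mem' := by
    intro c x hx i
    have h : tA k I i • (c • x) = c • (tA k I i • x) := by
      rw [← algebraMap_smul (Weyl k I) c x, ← algebraMap_smul (Weyl k I) c (tA k I i • x),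
        smul_smul, smul_smul, Algebra.commutes]
    rw [h, hx i, smul_smul, smul_smul, mul_comm]

/-- The set `p̄` of weights of `L(p)`: all `m = p + v`, `v` finitely supported integral, such
that negative-integrality and nonnegative-integrality of coordinates is inherited from `p`. -/
def pbar (p : I → k) : Set (I → k) :=
  {m | (∃ v : I →₀ ℤ, m = fun i => p i + ((v i : ℤ) : k)) ∧
    ∀ i, (IsNegInt k (p i) → IsNegInt k (m i)) ∧ (IsNonnegInt k (p i) → IsNonnegInt k (m i))}

variable {k I}

/-- The coefficient of `e_v` in an element of `B(p)`, as a linear form. -/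
def coeffV (ρ : Weyl k I →ₐ[k] Module.End k ((I →₀ ℤ) →₀ k)) (v : I →₀ ℤ) :
    BMod k I ρ →ₗ[k] k :=
  Finsupp.lapply (R := k) (M := k) v

/-- The weight `p + v` of the basis vector `e_v`. -/
def wtV (p : I → k) (v : I →₀ ℤ) : I → k := fun i => p i + ((v i : ℤ) : k)

section Coefficients

variable {ρ : Weyl k I →ₐ[k] Module.End k ((I →₀ ℤ) →₀ k)}

theorem coeffV_eV_self (v : I →₀ ℤ) : coeffV ρ v (eV k I ρ v) = 1 :=
  Finsupp.single_eq_same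

theorem coeffV_eV_of_ne {v w : I →₀ ℤ} (h : w ≠ v) : coeffV ρ w (eV k I ρ v) = 0 :=
  Finsupp.single_eq_of_ne h

theorem mem_span_eV_iff (s : Set (I →₀ ℤ)) (x : BMod k I ρ) :
    x ∈ Submodule.span k {x | ∃ v ∈ s, x = eV k I ρ v} ↔ ∀ v ∉ s, coeffV ρ v x = 0 := by
  have hs : {x : BMod k I ρ | ∃ v ∈ s, x = eV k I ρ v} =
      (fun v => (Finsupp.single v 1 : (I →₀ ℤ) →₀ k)) '' s := by
    ext y
    exact ⟨fun ⟨v, hv, h⟩ => ⟨v, hv, h.symm⟩, fun ⟨v, hv, h⟩ => ⟨v, hv, h.symm⟩⟩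
  rw [hs]
  have h := Finsupp.supported_eq_span_single k s
  exact (SetLike.ext_iff.mp h x).symm.trans (Finsupp.mem_supported' (R := k) (x : (I →₀ ℤ) →₀ k))

theorem Sop_comp_Dop (p : I → k) (i : I) (x : (I →₀ ℤ) →₀ k) (v : I →₀ ℤ) :
    Sop k I i (Dop k I p i x) v = wtV p v i * x v := by
  induction x using Finsupp.induction_linear with
  | zero => simp
  | add f g hf hg => simp [hf, hg, mul_add]
  | single w a =>
    have hD : Dop k I p i (Finsupp.single w a) =
        Finsupp.single (w - Finsupp.single i 1) (a * wtV p w i) := by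
      rw [Dop, Finsupp.lsum_single, LinearMap.toSpanSingleton_apply, smul_smul,
        Finsupp.smul_single, smul_eq_mul, mul_one, wtV]
    have hS : Sop k I i (Dop k I p i (Finsupp.single w a)) =
        Finsupp.single w (a * wtV p w i) := by
      rw [hD, Sop, Finsupp.lmapDomain_apply, Finsupp.mapDomain_single, sub_add_cancel]
    rw [hS]
    by_cases h : w = v
    · rw [h, Finsupp.single_eq_same, Finsupp.single_eq_same, mul_comm]
    · rw [Finsupp.single_eq_of_ne' h, Finsupp.single_eq_of_ne' h, mul_zero]

theorem coeffV_tA_smul {p : I → k} (hX : ∀ i, ρ (XA k I i) = Sop k I i)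
    (hY : ∀ i, ρ (YA k I i) = Dop k I p i) (i : I) (x : BMod k I ρ) (v : I →₀ ℤ) :
    coeffV ρ v (tA k I i • x) = wtV p v i * coeffV ρ v x := by
  have h : tA k I i • x = Sop k I i (Dop k I p i x) := by
    change ρ (XA k I i * YA k I i) x = _
    rw [map_mul, hX, hY]
    rfl
  rw [h]
  exact Sop_comp_Dop p i x v

end Coefficients

theorem wtV_injective [CharZero k] (p : I → k) : Function.Injective (wtV p) := by
  intro v w h
  ext i
  simpa [wtV] using congrFun h i

theorem IsNegInt.not_isNonnegInt [CharZero k] {c : k} (h : IsNegInt k c) :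
    ¬ IsNonnegInt k c := by
  rintro ⟨n, rfl⟩
  obtain ⟨m, hm, h⟩ := h
  have : (n : ℤ) = m := by exact_mod_cast h
  omega

theorem IsNegInt.add_intCast {c : k} (h : IsNegInt k c) (z : ℤ)
    (hz : ¬ IsNonnegInt k (c + z)) : IsNegInt k (c + z) := by
  obtain ⟨m, -, rfl⟩ := h
  refine ⟨m + z, not_le.mp fun hle => hz ?_, by push_cast; rfl⟩
  obtain ⟨n, hn⟩ := Int.eq_ofNat_of_zero_le hle
  exact ⟨n, by exact_mod_cast congrArg (Int.cast (R := k)) hn⟩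

theorem wtV_mem_pbar_iff [CharZero k] (p : I → k) (v : I →₀ ℤ) :
    wtV p v ∈ pbar k I p ↔ v ∈ Sset k I p ∧ v ∉ Sset'' k I p := by
  constructor
  · rintro ⟨-, h⟩
    exact ⟨fun i => (h i).2, fun ⟨_, i, hi, hn⟩ => ((h i).1 hi).not_isNonnegInt hn⟩
  · rintro ⟨hv, hv'⟩
    exact ⟨⟨v, rfl⟩, fun i =>
      ⟨fun hi => hi.add_intCast _ fun hn => hv' ⟨hv, i, hi, hn⟩, hv i⟩⟩

variable (k I)

/-- The support of `L(p) = N ⧸ N''` is exactly `p̄`, and each weight space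
of a weight in `p̄` is one-dimensional over `k`. -/
theorem support_of_Lp [IsAlgClosed k] [CharZero k] [Infinite I]
    (p : I → k) (ρ : Weyl k I →ₐ[k] Module.End k ((I →₀ ℤ) →₀ k))
    (hX : ∀ i, ρ (XA k I i) = Sop k I i) (hY : ∀ i, ρ (YA k I i) = Dop k I p i)
    (NA NA'' : Submodule (Weyl k I) (BMod k I ρ))
    (hNA : (NA : Set (BMod k I ρ)) = (Nspan k I p ρ : Set (BMod k I ρ)))
    (hNA'' : (NA'' : Set (BMod k I ρ)) = (Nspan'' k I p ρ : Set (BMod k I ρ)))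
    (m : I → k) :
    (wtSp k I (NA ⧸ Submodule.comap NA.subtype NA'') m ≠ ⊥ ↔ m ∈ pbar k I p) ∧
    (m ∈ pbar k I p →
      Module.finrank k (wtSp k I (NA ⧸ Submodule.comap NA.subtype NA'') m) = 1) := by
  have memN (x : BMod k I ρ) : x ∈ NA ↔ ∀ v ∉ Sset k I p, coeffV ρ v x = 0 :=
    (Set.ext_iff.mp hNA x).trans (mem_span_eV_iff _ x)
  have memN'' (x : BMod k I ρ) : x ∈ NA'' ↔ ∀ v ∉ Sset'' k I p, coeffV ρ v x = 0 :=
    (Set.ext_iff.mp hNA'' x).trans (mem_span_eV_iff _ x)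
  set Q := Submodule.comap NA.subtype NA''
  have mk_eq_zero (x : NA) : Submodule.Quotient.mk (p := Q) x = 0 ↔
      ∀ v ∉ Sset'' k I p, coeffV ρ v (x : BMod k I ρ) = 0 :=
    (Submodule.Quotient.mk_eq_zero Q).trans (memN'' x)
  have mk_mem (x : NA) : Submodule.Quotient.mk (p := Q) x ∈ wtSp k I (NA ⧸ Q) m ↔
      ∀ v ∉ Sset'' k I p, coeffV ρ v (x : BMod k I ρ) ≠ 0 → wtV p v = m := by
    have coeff_sub (i : I) (v : I →₀ ℤ) :
        coeffV ρ v ((tA k I i • x - m i • x : NA) : BMod k I ρ) =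
          (wtV p v i - m i) * coeffV ρ v (x : BMod k I ρ) := by
      change coeffV ρ v (tA k I i • (x : BMod k I ρ) - m i • (x : BMod k I ρ)) = _
      rw [map_sub, coeffV_tA_smul hX hY, map_smul, smul_eq_mul, sub_mul]
    have h : Submodule.Quotient.mk (p := Q) x ∈ wtSp k I (NA ⧸ Q) m ↔
        ∀ i, Submodule.Quotient.mk (p := Q) (tA k I i • x - m i • x) = 0 :=
      forall_congr' fun i => sub_eq_zero.symm
    simp only [h, mk_eq_zero, coeff_sub, mul_eq_zero, sub_eq_zero, _root_.funext_iff]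
    exact ⟨fun H v hv hx i => (H i v hv).resolve_right hx,
      fun H i v hv => or_iff_not_imp_right.mpr fun hx => H v hv hx i⟩
  have finrank_eq_one (hm : m ∈ pbar k I p) :
      Module.finrank k (wtSp k I (NA ⧸ Q) m) = 1 := by
    obtain ⟨v, rfl⟩ : ∃ v, m = wtV p v := hm.1
    obtain ⟨hv, hv''⟩ := (wtV_mem_pbar_iff p v).mp hm
    let e : NA := ⟨eV k I ρ v, (memN _).mpr fun w hw =>
      coeffV_eV_of_ne fun h => hw (h ▸ hv)⟩
    have he : Submodule.Quotient.mk (p := Q) e ∈ wtSp k I (NA ⧸ Q) (wtV p v) := by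
      refine (mk_mem e).mpr fun w _ hw => ?_
      by_contra hne
      exact hw (coeffV_eV_of_ne fun h => hne (h ▸ rfl))
    refine finrank_eq_one_iff'.mpr ⟨⟨_, he⟩, fun h => ?_, ?_⟩
    · have := (mk_eq_zero e).mp (congrArg Subtype.val h) v hv''
      exact one_ne_zero ((coeffV_eV_self v).symm.trans this)
    · rintro ⟨y, hy⟩
      obtain ⟨x, rfl⟩ := Submodule.Quotient.mk_surjective Q y
      refine ⟨coeffV ρ v (x : BMod k I ρ), Subtype.ext (sub_eq_zero.mp ?_)⟩
      refine (mk_eq_zero (coeffV ρ v (x : BMod k I ρ) • e - x)).mpr fun w hw => ?_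
      change coeffV ρ w (coeffV ρ v (x : BMod k I ρ) • eV k I ρ v - (x : BMod k I ρ)) = 0
      rw [map_sub, map_smul, smul_eq_mul]
      by_cases hwv : w = v
      · rw [hwv, coeffV_eV_self, mul_one, sub_self]
      · rw [coeffV_eV_of_ne hwv, mul_zero, zero_sub, neg_eq_zero]
        by_contra hx
        exact hwv (wtV_injective p ((mk_mem x).mp hy w hw hx))
  refine ⟨⟨fun hne => ?_, fun hm hbot => ?_⟩, finrank_eq_one⟩
  · obtain ⟨y, hy, hy0⟩ := Submodule.exists_mem_ne_zero_of_ne_bot hne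
    obtain ⟨x, rfl⟩ := Submodule.Quotient.mk_surjective Q y
    rw [Ne, mk_eq_zero] at hy0
    push Not at hy0
    obtain ⟨v, hv'', hx⟩ := hy0
    rw [← (mk_mem x).mp hy v hv'' hx, wtV_mem_pbar_iff]
    exact ⟨by_contra fun hv => hx ((memN x).mp x.2 v hv), hv''⟩
  · have h := finrank_eq_one hm
    rw [hbot, finrank_bot] at h
    exact zero_ne_one h
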